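/- Let w be a Bergman weight with h_0 = 1 whose moments satisfy h_{2m}/h_{2(m-1)} ≥ h_{2(m+1)}/((m+1)·h_{2(m-1)}) + (m/(m+1))·h_{2(m+1)}/h_{2m} for all integers m ≥ 1. Then ∑_{n=0}^∞ h_{2(n+1)}/((n!)²(n+1)) ≤ (∑_{n=0}^∞ h_{2n}/(n!)²)·ln(∑_{n=0}^∞ h_{2n}/(n!)²). -/

import Mathlib

open MeasureTheory

/-- The `m`-th moment `h_m = ∫₀¹ ρ^{m+1} w(ρ) dρ` of a weight `w` on `[0,1)`. -/
noncomputable def moment (w : ℝ → ℝ) (m : ℕ) : ℝ :=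
  ∫ ρ in (0:ℝ)..1, ρ ^ (m + 1) * w ρ

/-- Chebyshev's sum inequality with nonnegative summable weights. -/
theorem tsum_mul_tsum_le_of_monovary {ι : Type*} {b f g : ι → ℝ} (hb : ∀ i, 0 ≤ b i)
    (hfg : Monovary f g) (sb : Summable b) (sf : Summable fun i => b i * f i)
    (sg : Summable fun i => b i * g i) (sfg : Summable fun i => b i * (f i * g i)) :
    (∑' i, b i * f i) * (∑' i, b i * g i) ≤ (∑' i, b i) * ∑' i, b i * (f i * g i) := by
  have key (j : ι) : 0 ≤ (∑' i, b i * (f i * g i)) - g j * (∑' i, b i * f i)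
      - f j * (∑' i, b i * g i) + f j * g j * ∑' i, b i := by
    rw [← tsum_mul_left, ← tsum_mul_left, ← tsum_mul_left,
      ← sfg.tsum_sub (sf.mul_left _), ← (sfg.sub (sf.mul_left _)).tsum_sub (sg.mul_left _),
      ← ((sfg.sub (sf.mul_left _)).sub (sg.mul_left _)).tsum_add (sb.mul_left _)]
    refine tsum_nonneg fun i => ?_
    have h : 0 ≤ (f j - f i) * (g j - g i) := by
      simpa using monovary_iff_forall_mul_nonneg.1 hfg i j
    nlinarith [mul_nonneg (hb i) h]
  set S := ∑' i, b i
  set P := ∑' i, b i * f i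
  set Q := ∑' i, b i * g i
  set R := ∑' i, b i * (f i * g i)
  have h : 0 ≤ S * R - Q * P - P * Q + R * S := by
    have h1 := sb.hasSum.mul_right R
    have h2 := sg.hasSum.mul_right P
    have h3 := sf.hasSum.mul_right Q
    have h4 := sfg.hasSum.mul_right S
    refine (((h1.sub h2).sub h3).add h4).nonneg fun j => ?_
    have := mul_nonneg (hb j) (key j)
    nlinarith
  linarith

theorem summable_mul_pow_of_le_inv_factorial {b : ℕ → ℝ} (hb : ∀ n, 0 ≤ b n)
    (hle : ∀ n, b n ≤ 1 / (n.factorial : ℝ)) {q : ℝ} (hq : 0 ≤ q) :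
    Summable fun n => b n * q ^ n := by
  refine (Real.summable_pow_div_factorial q).of_nonneg_of_le
    (fun n => mul_nonneg (hb n) (pow_nonneg hq n)) fun n => ?_
  have := mul_le_mul_of_nonneg_right (hle n) (pow_nonneg hq n)
  rwa [one_div_mul_eq_div] at this

theorem succ_mul_le_inv_factorial {b : ℕ → ℝ} (hle : ∀ n, b n ≤ 1 / (n.factorial : ℝ)) (n : ℕ) :
    ((n : ℝ) + 1) * b (n + 1) ≤ 1 / (n.factorial : ℝ) := by
  have := mul_le_mul_of_nonneg_left (hle (n + 1)) (by positivity : (0 : ℝ) ≤ (n : ℝ) + 1)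
  refine this.trans_eq ?_
  rw [Nat.factorial_succ]
  push_cast
  field_simp

theorem hasDerivAt_tsum_mul_pow {b : ℕ → ℝ} (hb : ∀ n, 0 ≤ b n)
    (hle : ∀ n, b n ≤ 1 / (n.factorial : ℝ)) {q : ℝ} (hq : |q| < 2) :
    HasDerivAt (fun x => ∑' n, b n * x ^ n) (∑' n : ℕ, ((n : ℝ) + 1) * b (n + 1) * q ^ n) q := by
  have hd (n : ℕ) : 0 ≤ ((n : ℝ) + 1) * b (n + 1) := mul_nonneg (by positivity) (hb _)
  have hbound (n : ℕ) (x : ℝ) (hx : x ∈ Metric.ball (0 : ℝ) 2) :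
      ‖b n * (n * x ^ (n - 1))‖ ≤ b n * (n * 2 ^ (n - 1)) := by
    rw [Metric.mem_ball, dist_zero_right] at hx
    rw [norm_mul, norm_mul, norm_pow, Real.norm_of_nonneg (hb n), RCLike.norm_natCast]
    have := hb n
    gcongr
  have hsum : Summable fun n : ℕ => b n * (n * (2 : ℝ) ^ (n - 1)) := by
    rw [← summable_nat_add_iff 1]
    refine (summable_mul_pow_of_le_inv_factorial hd (succ_mul_le_inv_factorial hle)
      (zero_le_two : (0 : ℝ) ≤ 2)).congr fun n => ?_
    rw [Nat.add_sub_cancel]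
    push_cast
    ring
  have hq' : q ∈ Metric.ball (0 : ℝ) 2 := by simpa using hq
  have h := hasDerivAt_tsum_of_isPreconnected hsum Metric.isOpen_ball
    (convex_ball (0 : ℝ) 2).isPreconnected
    (fun n x _ => (hasDerivAt_pow n x).const_mul (b n)) hbound
    (Metric.mem_ball_self two_pos)
    (by simpa using summable_mul_pow_of_le_inv_factorial hb hle le_rfl) hq'
  refine h.congr_deriv ?_
  rw [(hsum.of_norm_bounded fun n => hbound n q hq').tsum_eq_zero_add]
  simp only [Nat.cast_zero, zero_mul, mul_zero, zero_add, Nat.add_sub_cancel]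
  refine tsum_congr fun n => ?_
  push_cast
  ring

/-- If the ratios `(n + 1) b (n + 1) / b n` decrease, then `F q = ∑ b n q ^ n` is log-concave
on `[0, 1]`, which gives `F' 1 ≤ F 1 * log (F 1)`. -/
theorem tsum_succ_mul_le_mul_log {b : ℕ → ℝ} (hb : ∀ n, 0 < b n) (h0 : b 0 = 1)
    (hle : ∀ n, b n ≤ 1 / (n.factorial : ℝ))
    (hanti : Antitone fun n : ℕ => ((n : ℝ) + 1) * b (n + 1) / b n) :
    ∑' n : ℕ, ((n : ℝ) + 1) * b (n + 1) ≤ (∑' n, b n) * Real.log (∑' n, b n) := by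
  have hb' (n : ℕ) : 0 ≤ b n := (hb n).le
  have hd (n : ℕ) : 0 ≤ ((n : ℝ) + 1) * b (n + 1) := mul_nonneg (by positivity) (hb' _)
  have sF {q : ℝ} (hq : 0 ≤ q) := summable_mul_pow_of_le_inv_factorial hb' hle hq
  have sD {q : ℝ} (hq : 0 ≤ q) :=
    summable_mul_pow_of_le_inv_factorial hd (succ_mul_le_inv_factorial hle) hq
  have hF {q : ℝ} (hq : 0 ≤ q) : 0 < ∑' n, b n * q ^ n :=
    (sF hq).tsum_pos (fun n => mul_nonneg (hb' n) (pow_nonneg hq n)) 0 (by simp [h0])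
  have hS : 0 < ∑' n, b n := by simpa using hF zero_le_one
  have sb : Summable b := by simpa using sF zero_le_one
  have sd : Summable fun n : ℕ => ((n : ℝ) + 1) * b (n + 1) := by simpa using sD zero_le_one
  set F : ℝ → ℝ := fun q => ∑' n, b n * q ^ n with hFdef
  set D : ℝ → ℝ := fun q => ∑' n : ℕ, ((n : ℝ) + 1) * b (n + 1) * q ^ n
  set S := ∑' n, b n
  set T := ∑' n : ℕ, ((n : ℝ) + 1) * b (n + 1)
  have cheb {q : ℝ} (hq : 0 ≤ q) (hq1 : q ≤ 1) : T * F q ≤ S * D q := by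
    have e (n : ℕ) : b n * (((n : ℝ) + 1) * b (n + 1) / b n) = ((n : ℝ) + 1) * b (n + 1) :=
      mul_div_cancel₀ _ (hb n).ne'
    have e' (n : ℕ) : b n * (((n : ℝ) + 1) * b (n + 1) / b n * q ^ n)
        = ((n : ℝ) + 1) * b (n + 1) * q ^ n := by rw [← mul_assoc, e]
    have := tsum_mul_tsum_le_of_monovary hb'
      (hanti.monovary (pow_right_anti₀ hq hq1)) sb (by simpa only [e] using sd) (sF hq)
      (by simpa only [e'] using sD hq)
    simpa only [e, e'] using this
  have hderiv {q : ℝ} (hq : 0 ≤ q) (hq1 : q ≤ 1) :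
      HasDerivAt (fun x => Real.log (F x) - T / S * x) (D q / F q - T / S) q := by
    have h1 : HasDerivAt F (D q) q :=
      hasDerivAt_tsum_mul_pow hb' hle (by rw [abs_of_nonneg hq]; linarith)
    exact ((h1.log (hF hq).ne').sub ((hasDerivAt_id q).const_mul (T / S))).congr_deriv
      (by rw [mul_one])
  have hmono : MonotoneOn (fun x => Real.log (F x) - T / S * x) (Set.Icc 0 1) := by
    refine monotoneOn_of_deriv_nonneg (convex_Icc 0 1)
      (fun x hx => (hderiv hx.1 hx.2).continuousAt.continuousWithinAt) ?_ ?_ <;>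
      intro x hx <;> rw [interior_Icc] at hx
    · exact (hderiv hx.1.le hx.2.le).differentiableAt.differentiableWithinAt
    · rw [(hderiv hx.1.le hx.2.le).deriv, sub_nonneg, div_le_div_iff₀ hS (hF hx.1.le)]
      linarith [cheb hx.1.le hx.2.le]
  have h := hmono (Set.left_mem_Icc.2 zero_le_one) (Set.right_mem_Icc.2 zero_le_one) zero_le_one
  have hF0 : F 0 = 1 := by
    simp only [hFdef]
    rw [tsum_eq_single 0 fun n hn => by simp [hn]]
    simp [h0]
  have hF1 : F 1 = S := by simp [hFdef, S]
  simp only [hF0, hF1, Real.log_one, mul_zero, mul_one, sub_zero, sub_nonneg] at h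
  rwa [div_le_iff₀' hS] at h

theorem moment_antitone {w : ℝ → ℝ} (hw_nonneg : ∀ ρ ∈ Set.Ico (0:ℝ) 1, 0 ≤ w ρ)
    (hw_int : ∀ m : ℕ, IntervalIntegrable (fun ρ => ρ ^ (m + 1) * w ρ) volume 0 1) :
    Antitone (moment w) := by
  refine fun m k hmk => intervalIntegral.integral_mono_on_of_le_Ioo zero_le_one
    (hw_int k) (hw_int m) fun ρ hρ => ?_
  exact mul_le_mul_of_nonneg_right
    (pow_le_pow_of_le_one hρ.1.le hρ.2.le (Nat.add_le_add_right hmk 1))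
    (hw_nonneg ρ ⟨hρ.1.le, hρ.2⟩)

theorem moment_pos {w : ℝ → ℝ} (hw_nonneg : ∀ ρ ∈ Set.Ico (0:ℝ) 1, 0 ≤ w ρ)
    (hw_int : ∀ m : ℕ, IntervalIntegrable (fun ρ => ρ ^ (m + 1) * w ρ) volume 0 1)
    (h0 : 0 < moment w 0) (m : ℕ) : 0 < moment w m := by
  have hae : ∀ᵐ ρ : ℝ ∂volume.restrict (Set.Ioc 0 1), ρ ∈ Set.Ioo (0 : ℝ) 1 := by
    rw [← Measure.restrict_congr_set Ioo_ae_eq_Ioc]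
    exact ae_restrict_mem measurableSet_Ioo
  have hnn : 0 ≤ᵐ[volume.restrict (Set.Ioc 0 1)] fun ρ => ρ ^ (m + 1) * w ρ := by
    filter_upwards [hae] with ρ hρ
    exact mul_nonneg (pow_nonneg hρ.1.le _) (hw_nonneg ρ ⟨hρ.1.le, hρ.2⟩)
  refine lt_of_le_of_ne
    (intervalIntegral.integral_nonneg_of_ae_restrict zero_le_one ?_) fun hm => h0.ne' ?_
  · rwa [← restrict_Ioc_eq_restrict_Icc]
  · have hz := (intervalIntegral.integral_eq_zero_iff_of_le_of_nonneg_ae zero_le_one hnn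
      (hw_int m)).1 hm.symm
    refine intervalIntegral.integral_zero_ae ?_
    rw [Set.uIoc_of_le zero_le_one, ← ae_restrict_iff' measurableSet_Ioc]
    filter_upwards [hz, hae] with ρ h1 h2
    rcases mul_eq_zero.1 h1 with h | h
    · exact absurd h (pow_pos h2.1 _).ne'
    · simp [h]

/-- If the moments of a Bergman weight `w` satisfy
`h_{2m}/h_{2(m-1)} ≥ h_{2(m+1)}/((m+1)h_{2(m-1)}) + (m/(m+1))·h_{2(m+1)}/h_{2m}` for all
`m ≥ 1`, then `∑ h_{2(n+1)}/((n!)²(n+1)) ≤ (∑ h_{2n}/(n!)²)·ln(∑ h_{2n}/(n!)²)`,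
i.e. the derivative at `q = 1` of
`φ(q) = ln(∑ qⁿ h_{2n}/(n!)²) − q·ln(∑ h_{2n}/(n!)²)` is nonpositive. -/
theorem derivative_at_one_nonpositive (w : ℝ → ℝ)
    (hw_nonneg : ∀ ρ ∈ Set.Ico (0:ℝ) 1, 0 ≤ w ρ)
    (hw_int : ∀ m : ℕ, IntervalIntegrable (fun ρ => ρ ^ (m + 1) * w ρ) volume 0 1)
    (h0 : moment w 0 = 1)
    (hcond : ∀ m : ℕ, 1 ≤ m →
      moment w (2 * (m + 1)) / ((m + 1) * moment w (2 * (m - 1))) +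
          ((m : ℝ) / (m + 1)) * (moment w (2 * (m + 1)) / moment w (2 * m)) ≤
        moment w (2 * m) / moment w (2 * (m - 1))) :
    ∑' n : ℕ, moment w (2 * (n + 1)) / ((Nat.factorial n : ℝ) ^ 2 * (n + 1)) ≤
      (∑' n : ℕ, moment w (2 * n) / (Nat.factorial n : ℝ) ^ 2) *
        Real.log (∑' n : ℕ, moment w (2 * n) / (Nat.factorial n : ℝ) ^ 2) := by
  have hpos := moment_pos hw_nonneg hw_int (h0 ▸ one_pos)
  have hle (n : ℕ) : moment w (2 * n) / (n.factorial : ℝ) ^ 2 ≤ 1 / (n.factorial : ℝ) := by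
    have h1 : (1 : ℝ) ≤ n.factorial := by exact_mod_cast n.factorial_pos
    refine div_le_div₀ zero_le_one ?_ (by positivity) (le_self_pow₀ h1 two_ne_zero)
    exact h0 ▸ moment_antitone hw_nonneg hw_int (Nat.zero_le _)
  have hshift (n : ℕ) : ((n : ℝ) + 1) * (moment w (2 * (n + 1)) / ((n + 1).factorial : ℝ) ^ 2)
      = moment w (2 * (n + 1)) / ((n.factorial : ℝ) ^ 2 * (n + 1)) := by
    rw [Nat.factorial_succ]
    push_cast
    field_simp
  have hratio (n : ℕ) : ((n : ℝ) + 1) * (moment w (2 * (n + 1)) / ((n + 1).factorial : ℝ) ^ 2)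
      / (moment w (2 * n) / (n.factorial : ℝ) ^ 2)
      = moment w (2 * (n + 1)) / ((n + 1) * moment w (2 * n)) := by
    have := hpos (2 * n)
    rw [hshift]
    field_simp
  have key := tsum_succ_mul_le_mul_log
    (b := fun n => moment w (2 * n) / (n.factorial : ℝ) ^ 2)
    (fun n => div_pos (hpos _) (by positivity)) (by simp [h0]) hle
    (antitone_nat_of_succ_le fun n => ?_)
  · simpa only [hshift] using key
  · simp only [hratio]
    have hc := hcond (n + 1) n.succ_pos
    simp only [Nat.add_sub_cancel] at hc
    have p0 := hpos (2 * n)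
    have p1 := hpos (2 * (n + 1))
    have p2 := hpos (2 * (n + 1 + 1))
    push_cast at hc ⊢
    have hdrop := (le_add_of_nonneg_left (by positivity)).trans hc
    calc moment w (2 * (n + 1 + 1)) / (((n : ℝ) + 1 + 1) * moment w (2 * (n + 1)))
        = ((n : ℝ) + 1) / (n + 1 + 1) * (moment w (2 * (n + 1 + 1)) / moment w (2 * (n + 1)))
            / (n + 1) := by field_simp
      _ ≤ moment w (2 * (n + 1)) / moment w (2 * n) / (n + 1) := by gcongr
      _ = moment w (2 * (n + 1)) / ((n + 1) * moment w (2 * n)) := by field_simp
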